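/- arXiv:2604.02439 — 5 statements merged into one kernel-verified Lean document; each statement's English description precedes it below -/
import Mathlib

section
/- If ρ and σ are density matrices on ℂ^d ⊗ ℂ^d such that ρ ∈ r-ABSN and ρ majorizes σ (ρ ≻ σ), then σ also belongs to r-ABSN. -/
open Matrix BigOperators
open scoped ComplexOrder

/-- The space of complex matrices acting on `ℂ^d ⊗ ℂ^d`. -/
abbrev MatD (d : ℕ) := Matrix (Fin d × Fin d) (Fin d × Fin d) ℂ

/-- A density matrix on `ℂ^d ⊗ ℂ^d`: positive semidefinite with trace 1. -/
def IsDensity (d : ℕ) (ρ : MatD d) : Prop :=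
  ρ.PosSemidef ∧ ρ.trace = 1

/-- `ρ` has Schmidt number at most `r`: it is a finite convex combination of rank-one
projections onto unit vectors `ψ_k` whose Schmidt rank (the rank of the associated
`d × d` matrix) is at most `r`. -/
def InSchmidt (d r : ℕ) (ρ : MatD d) : Prop :=
  ∃ (n : ℕ) (p : Fin n → ℝ) (ψ : Fin n → (Fin d × Fin d) → ℂ),
    (∀ k, 0 ≤ p k) ∧ (∑ k, p k = 1) ∧
    (∀ k, ∑ x, Complex.normSq (ψ k x) = 1) ∧
    (∀ k, (Matrix.of (fun i j => ψ k (i, j))).rank ≤ r) ∧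
    ρ = ∑ k, (p k : ℂ) • Matrix.vecMulVec (ψ k) (star (ψ k))

/-- `ρ` belongs to `r`-ABSN: it is a density matrix and `U ρ U†` has Schmidt number
at most `r` for every global unitary `U`. -/
def InABSN (d r : ℕ) (ρ : MatD d) : Prop :=
  IsDensity d ρ ∧
  ∀ U ∈ Matrix.unitaryGroup (Fin d × Fin d) ℂ, InSchmidt d r (U * ρ * star U)

/-- `a` majorizes `b` (for vectors of eigenvalues): the total sums agree, and for
every `k`, the sum of the `k` largest entries of `b` is at most the sum of the `k`
largest entries of `a` (expressed via subset sums: every `k`-subset-sum of `b` is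
dominated by some `k`-subset-sum of `a`). -/
def MajorizesVec {ι : Type} [Fintype ι] (a b : ι → ℝ) : Prop :=
  (∑ i, a i = ∑ i, b i) ∧
  ∀ t : Finset ι, ∃ s : Finset ι, s.card = t.card ∧ ∑ i ∈ t, b i ≤ ∑ i ∈ s, a i

/-- Abel summation: if all initial sums of `x` are nonnegative and `c` is antitone, then
`∑ c i * x i` is at least the last weight times the total. -/
lemma Antitone.last_mul_sum_le_sum_mul {n : ℕ} {c x : Fin (n + 1) → ℝ} (hc : Antitone c)
    (hx : ∀ k, 0 ≤ ∑ i ∈ Finset.Iic k, x i) :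
    c (Fin.last n) * ∑ i, x i ≤ ∑ i, c i * x i := by
  induction n with
  | zero => simp
  | succ n ih =>
    have hIic (k : Fin (n + 1)) :
        ∑ i ∈ Finset.Iic k.castSucc, x i = ∑ i ∈ Finset.Iic k, x i.castSucc := by
      rw [← Fin.map_castSuccEmb_Iic, Finset.sum_map]
      rfl
    have h := ih (c := fun i => c i.castSucc) (x := fun i => x i.castSucc)
      (fun i j hij => hc (Fin.castSucc_le_castSucc_iff.2 hij)) (fun k => hIic k ▸ hx _)
    have hnonneg : 0 ≤ ∑ i : Fin (n + 1), x i.castSucc := by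
      have h' := hIic (Fin.last n) ▸ hx (Fin.last n).castSucc
      rwa [← Fin.top_eq_last, Finset.Iic_top] at h'
    have hle : c (Fin.last (n + 1)) ≤ c (Fin.last n).castSucc := hc (Fin.le_last _)
    rw [Fin.sum_univ_castSucc x, Fin.sum_univ_castSucc (fun i => c i * x i)]
    nlinarith [mul_le_mul_of_nonneg_right hle hnonneg]

/-- For an antitone family on `Fin n`, the initial segment of a given size has the largest sum
among all subsets of that size. -/
lemma Antitone.sum_le_sum_Iic {n : ℕ} {a : Fin n → ℝ} (ha : Antitone a) (k : Fin n)
    (s : Finset (Fin n)) (hs : s.card = (Finset.Iic k).card) :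
    ∑ i ∈ s, a i ≤ ∑ i ∈ Finset.Iic k, a i := by
  have hcard : (s \ Finset.Iic k).card = (Finset.Iic k \ s).card :=
    Finset.card_sdiff_comm hs
  have h₁ : ∑ i ∈ s \ Finset.Iic k, a i ≤ (s \ Finset.Iic k).card • a k :=
    Finset.sum_le_card_nsmul _ _ _ fun i hi => ha <| by
      simp only [Finset.mem_sdiff, Finset.mem_Iic, not_le] at hi
      exact hi.2.le
  have h₂ : (Finset.Iic k \ s).card • a k ≤ ∑ i ∈ Finset.Iic k \ s, a i :=
    Finset.card_nsmul_le_sum _ _ _ fun i hi => ha <| by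
      simp only [Finset.mem_sdiff, Finset.mem_Iic] at hi
      exact hi.1
  have h₃ := Finset.sum_sdiff_sub_sum_sdiff (s₁ := Finset.Iic k) (s₂ := s) (f := a)
  rw [hcard] at h₁
  linarith

lemma exists_equiv_fin_antitone {ι : Type*} [Fintype ι] {n : ℕ} (hn : Fintype.card ι = n)
    (c : ι → ℝ) : ∃ e : Fin n ≃ ι, Antitone (c ∘ e) := by
  let e := (Fintype.equivFinOfCardEq hn).symm
  refine ⟨(Tuple.sort fun i => -c (e i)).trans e, fun i j hij => ?_⟩
  exact neg_le_neg_iff.1 (Tuple.monotone_sort (fun i => -c (e i)) hij)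

/-- If `a` majorizes `b`, then every linear functional is at least as large at some permutation
of `a` as at `b`. -/
lemma MajorizesVec.exists_perm_sum_mul_le {ι : Type} [Fintype ι] {a b : ι → ℝ}
    (h : MajorizesVec a b) (c : ι → ℝ) :
    ∃ π : Equiv.Perm ι, ∑ i, c i * b i ≤ ∑ i, c i * a (π i) := by
  obtain hn | ⟨n, hn⟩ : Fintype.card ι = 0 ∨ ∃ n, Fintype.card ι = n + 1 := by
    cases Fintype.card ι <;> simp
  · have := Fintype.card_eq_zero_iff.1 hn
    exact ⟨1, by simp⟩
  obtain ⟨e, he⟩ := exists_equiv_fin_antitone hn c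
  obtain ⟨f, hf⟩ := exists_equiv_fin_antitone hn a
  refine ⟨e.symm.trans f, ?_⟩
  rw [← e.sum_comp, ← e.sum_comp (fun i => c i * a ((e.symm.trans f) i))]
  have key := he.last_mul_sum_le_sum_mul (x := fun i => a (f i) - b (e i)) fun k => by
    obtain ⟨s, hs, hle⟩ := h.2 ((Finset.Iic k).map e.toEmbedding)
    have := hf.sum_le_sum_Iic k (s.map f.symm.toEmbedding) (by simpa using hs)
    simp only [Finset.sum_map, Equiv.coe_toEmbedding, Function.comp_apply,
      Equiv.apply_symm_apply] at this hle
    rw [Finset.sum_sub_distrib]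
    linarith
  have htot : ∑ i, (a (f i) - b (e i)) = 0 := by
    rw [Finset.sum_sub_distrib, f.sum_comp a, e.sum_comp b, h.1, sub_self]
  rw [htot, mul_zero] at key
  simp only [mul_sub, Finset.sum_sub_distrib, Function.comp_apply] at key
  simpa using key

/-- Rado's theorem: a vector majorized by `a` lies in the convex hull of the permutations
of `a`. -/
theorem MajorizesVec.mem_convexHull {ι : Type} [Fintype ι] {a b : ι → ℝ}
    (h : MajorizesVec a b) :
    b ∈ convexHull ℝ (Set.range fun π : Equiv.Perm ι => a ∘ π) := by
  classical
  by_contra hb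
  obtain ⟨f, u, hf, hu⟩ := geometric_hahn_banach_closed_point (convex_convexHull ℝ _)
    ((Set.finite_range _).isClosed_convexHull ℝ) hb
  have hsum (x : ι → ℝ) : f x = ∑ i, f (fun j => if i = j then 1 else 0) * x i := by
    simpa [mul_comm] using LinearMap.pi_apply_eq_sum_univ f.toLinearMap x
  obtain ⟨π, hπ⟩ := h.exists_perm_sum_mul_le fun i => f (fun j => if i = j then 1 else 0)
  have := hf _ (subset_convexHull ℝ _ ⟨π, rfl⟩)
  rw [hsum] at this hu
  simp only [Function.comp_apply] at this
  linarith

lemma convex_setOf_inSchmidt (d r : ℕ) : Convex ℝ {ρ : MatD d | InSchmidt d r ρ} := by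
  rintro _ ⟨n, p, ψ, hp, hp₁, hψ, hr, rfl⟩ _ ⟨m, q, φ, hq, hq₁, hφ, hs, rfl⟩ s t hs₀ ht₀ hst
  refine ⟨n + m, Fin.append (s • p) (t • q), Fin.append ψ φ, fun k => ?_, ?_, fun k => ?_,
    fun k => ?_, ?_⟩
  · refine Fin.addCases (fun i => ?_) (fun i => ?_) k
    · simpa using mul_nonneg hs₀ (hp i)
    · simpa using mul_nonneg ht₀ (hq i)
  · simp [Fin.sum_univ_add, ← Finset.mul_sum, hp₁, hq₁, hst]
  · refine Fin.addCases (fun i => ?_) (fun i => ?_) k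
    · simpa using hψ i
    · simpa using hφ i
  · refine Fin.addCases (fun i => ?_) (fun i => ?_) k
    · simpa using hr i
    · simpa using hs i
  · simp [Fin.sum_univ_add, Finset.smul_sum, mul_smul]

lemma permMatrix_mem_unitaryGroup {n : Type*} [Fintype n] [DecidableEq n] (π : Equiv.Perm n) :
    π.permMatrix ℂ ∈ Matrix.unitaryGroup n ℂ := by
  rw [Matrix.mem_unitaryGroup_iff, Matrix.star_eq_conjTranspose, Matrix.conjTranspose_permMatrix,
    ← Matrix.permMatrix_mul]
  simp

lemma permMatrix_mul_diagonal_mul_star {n : Type*} [Fintype n] [DecidableEq n]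
    (π : Equiv.Perm n) (x : n → ℂ) :
    π.permMatrix ℂ * Matrix.diagonal x * star (π.permMatrix ℂ) = Matrix.diagonal (x ∘ π) := by
  rw [Matrix.star_eq_conjTranspose, Matrix.conjTranspose_permMatrix,
    PEquiv.toMatrix_toPEquiv_mul, PEquiv.mul_toMatrix_toPEquiv]
  ext i j
  have h : π⁻¹.symm = π := rfl
  simp [Matrix.diagonal_apply, h]

/-- if `ρ ∈ r`-ABSN and `ρ` majorizes `σ`, then `σ ∈ r`-ABSN. -/
theorem absn_majorization (d r : ℕ) (hd : 1 ≤ d) (hr : 1 ≤ r)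
    (ρ σ : MatD d) (hρ : IsDensity d ρ) (hσ : IsDensity d σ)
    (hA : InABSN d r ρ)
    (hmaj : MajorizesVec hρ.1.1.eigenvalues hσ.1.1.eigenvalues) :
    InABSN d r σ := by
  refine ⟨hσ, fun U hU => ?_⟩
  let V := hσ.1.1.eigenvectorUnitary
  let W := hρ.1.1.eigenvectorUnitary
  let A : MatD d := U * V
  let D : (Fin d × Fin d → ℝ) → MatD d := fun x => Matrix.diagonal fun i => (x i : ℂ)
  have hσ_eq : σ = (V : MatD d) * D hσ.1.1.eigenvalues * star (V : MatD d) :=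
    hσ.1.1.spectral_theorem
  have hρ_eq : ρ = (W : MatD d) * D hρ.1.1.eigenvalues * star (W : MatD d) :=
    hρ.1.1.spectral_theorem
  have hD_eq : D hρ.1.1.eigenvalues = star (W : MatD d) * ρ * W := by
    have hW : star (W : MatD d) * W = 1 := Unitary.coe_star_mul_self W
    calc D hρ.1.1.eigenvalues
        = (star (W : MatD d) * W) * D hρ.1.1.eigenvalues * (star (W : MatD d) * W) := by
          rw [hW, one_mul, mul_one]
      _ = star (W : MatD d) * ((W : MatD d) * D hρ.1.1.eigenvalues * star (W : MatD d)) * W := by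
          simp only [mul_assoc]
      _ = star (W : MatD d) * ρ * W := by rw [← hρ_eq]
  have hconvex : Convex ℝ {x | InSchmidt d r (A * D x * star A)} := by
    intro x hx y hy s t hs ht hst
    have hD : D (s • x + t • y) = s • D x + t • D y := by
      ext i j
      by_cases hij : i = j <;> simp [D, hij]
    have := convex_setOf_inSchmidt d r hx hy hs ht hst
    simpa [hD, mul_add, add_mul] using this
  have hsub : Set.range (fun π : Equiv.Perm _ => hρ.1.1.eigenvalues ∘ π) ⊆
      {x | InSchmidt d r (A * D x * star A)} := by
    rintro _ ⟨π, rfl⟩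
    let P : MatD d := π.permMatrix ℂ
    have hmem : A * P * star (W : MatD d) ∈ Matrix.unitaryGroup (Fin d × Fin d) ℂ :=
      mul_mem (mul_mem (mul_mem hU V.2) (permMatrix_mem_unitaryGroup π)) (star W).2
    have hperm : D (hρ.1.1.eigenvalues ∘ π) = P * (star (W : MatD d) * ρ * W) * star P := by
      rw [← hD_eq]
      exact (permMatrix_mul_diagonal_mul_star π fun i => (hρ.1.1.eigenvalues i : ℂ)).symm
    simpa only [Set.mem_ofPred_eq, hperm, star_mul, star_star, mul_assoc] using hA.2 _ hmem
  have hmem := convexHull_min hsub hconvex hmaj.mem_convexHull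
  rw [hσ_eq]
  simpa only [Set.mem_ofPred_eq, A, star_mul, mul_assoc] using hmem
end

section
/- Let n ≥ 1 and let A be a Hermitian n×n complex matrix. If Re Tr(A) ≥ √(n−1) · √(Re Tr(A²)), then A is positive semidefinite. (In the paper this is stated for A acting on ℂ^d ⊗ ℂ^d, i.e. n = d², with threshold α = Tr(A)/√(Tr(A²)) ≥ √(d²−1).) -/
open Matrix BigOperators
open scoped ComplexOrder

/-- If the sum of finitely many reals is at least `√(n - 1)` times their Euclidean norm, where `n` is
the number of summands, then all of them are nonnegative. -/
theorem nonneg_of_sqrt_card_sub_one_mul_sqrt_sum_sq_le_sum {ι : Type*} [Fintype ι] (f : ι → ℝ)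
    (h : Real.sqrt ((Fintype.card ι : ℝ) - 1) * Real.sqrt (∑ i, f i ^ 2) ≤ ∑ i, f i) (i : ι) :
    0 ≤ f i := by
  classical
  by_contra! hi
  have hcard : ((Finset.univ.erase i).card : ℝ) = (Fintype.card ι : ℝ) - 1 := by
    rw [Finset.cast_card_erase_of_mem (Finset.mem_univ i), Finset.card_univ]
  have hm : 0 ≤ (Fintype.card ι : ℝ) - 1 := hcard ▸ Nat.cast_nonneg _
  have hcs := sq_sum_le_card_mul_sum_sq (s := Finset.univ.erase i) (f := f)
  rw [hcard] at hcs
  have hS := Finset.add_sum_erase Finset.univ f (Finset.mem_univ i)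
  have hQ := Finset.add_sum_erase Finset.univ (fun j => f j ^ 2) (Finset.mem_univ i)
  have hQ0 : 0 ≤ ∑ j, f j ^ 2 := Finset.sum_nonneg fun j _ => sq_nonneg _
  rw [← Real.sqrt_mul hm] at h
  have hS0 : 0 ≤ ∑ j, f j := (Real.sqrt_nonneg _).trans h
  have hsq := (Real.sqrt_le_left hS0).mp h
  have hle := mul_le_mul_of_nonneg_left
    (show ∑ j ∈ Finset.univ.erase i, f j ^ 2 ≤ ∑ j, f j ^ 2 by linarith [sq_nonneg (f i)]) hm
  have hlt := pow_lt_pow_left₀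
    (show ∑ j, f j < ∑ j ∈ Finset.univ.erase i, f j by linarith) hS0 two_ne_zero
  linarith

theorem Matrix.IsHermitian.trace_pow_eq_sum_eigenvalues_pow {𝕜 n : Type*} [RCLike 𝕜] [Fintype n]
    [DecidableEq n] {A : Matrix n n 𝕜} (hA : A.IsHermitian) (k : ℕ) :
    (A ^ k).trace = ∑ i, (hA.eigenvalues i : 𝕜) ^ k := by
  conv_lhs => rw [hA.spectral_theorem, ← map_pow, Unitary.conjStarAlgAut_apply,
    Matrix.trace_mul_cycle, Unitary.coe_star_mul_self, one_mul, Matrix.diagonal_pow,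
    Matrix.trace_diagonal]
  simp

/-- if a Hermitian `n × n` matrix `A` satisfies
`Re Tr(A) ≥ √(n−1) · √(Re Tr(A²))`, then `A` is positive semidefinite. -/
theorem mehta_positivity (n : ℕ) (hn : 1 ≤ n)
    (A : Matrix (Fin n) (Fin n) ℂ) (hA : A.IsHermitian)
    (h : Real.sqrt ((n : ℝ) - 1) * Real.sqrt (((A ^ 2).trace).re) ≤ (A.trace).re) :
    A.PosSemidef := by
  rw [hA.posSemidef_iff_eigenvalues_nonneg]
  refine nonneg_of_sqrt_card_sub_one_mul_sqrt_sum_sq_le_sum hA.eigenvalues ?_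
  have hQ : ((A ^ 2).trace).re = ∑ i, hA.eigenvalues i ^ 2 := by
    rw [hA.trace_pow_eq_sum_eigenvalues_pow]
    simp [← Complex.ofReal_pow]
  have hS : (A.trace).re = ∑ i, hA.eigenvalues i := by
    simp [hA.trace_eq_sum_eigenvalues]
  rwa [Fintype.card_fin, ← hQ, ← hS]
end

section
/- If ρ is a density matrix on ℂ³ ⊗ ℂ³ satisfying Tr(ρ²) ≤ 1/8, then for every unitary 9×9 matrix U the partial transpose (U ρ U†)^{T_B} is positive semidefinite; in particular (taking U = I) ρ itself is PPT. -/
open Matrix BigOperators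
open scoped ComplexOrder

/-- The partial transpose (on the second factor) of a matrix on `ℂ^d ⊗ ℂ^d`:
`X^{T_B} ((i,j),(k,l)) = X ((i,l),(k,j))`. -/
def ptB (d : ℕ) (X : MatD d) : MatD d :=
  Matrix.of fun p q => X (p.1, q.2) (q.1, p.2)

theorem Matrix.IsHermitian.trace_mul_self_eq_sum_eigenvalues_sq {n : Type*} [Fintype n]
    [DecidableEq n] {A : Matrix n n ℂ} (hA : A.IsHermitian) :
    ((A * A).trace).re = ∑ i, hA.eigenvalues i ^ 2 := by
  conv_lhs => rw [hA.spectral_theorem, ← map_mul, Unitary.conjStarAlgAut_apply]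
  rw [trace_mul_comm, ← mul_assoc, Unitary.coe_star_mul_self, one_mul, diagonal_mul_diagonal,
    trace_diagonal, Complex.re_sum]
  exact Finset.sum_congr rfl fun i _ => by simp [sq]

/-- A Hermitian matrix of nonnegative trace is positive semidefinite as soon as
`(n - 1) Tr(A²) ≤ (Tr A)²`. -/
theorem Matrix.IsHermitian.posSemidef_of_trace_mul_self_le {n : Type*} [Fintype n]
    [DecidableEq n] {A : Matrix n n ℂ} (hA : A.IsHermitian) (htr : 0 ≤ A.trace.re)
    (h : ((Fintype.card n : ℝ) - 1) * ((A * A).trace).re ≤ A.trace.re ^ 2) :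
    A.PosSemidef := by
  rw [hA.posSemidef_iff_eigenvalues_nonneg]
  intro i
  have hsum : A.trace.re = ∑ j, hA.eigenvalues j := by
    rw [hA.trace_eq_sum_eigenvalues]
    simp
  rw [hA.trace_mul_self_eq_sum_eigenvalues_sq, hsum,
    ← Finset.add_sum_erase _ _ (Finset.mem_univ i),
    ← Finset.add_sum_erase _ _ (Finset.mem_univ i)] at h
  rw [hsum, ← Finset.add_sum_erase _ _ (Finset.mem_univ i)] at htr
  have hcs := sq_sum_le_card_mul_sum_sq (s := Finset.univ.erase i) (f := hA.eigenvalues)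
  have hpos : 1 ≤ Fintype.card n := Fintype.card_pos_iff.mpr ⟨i⟩
  rw [Finset.card_erase_of_mem (Finset.mem_univ i), Finset.card_univ, Nat.cast_sub hpos,
    Nat.cast_one] at hcs
  have hcard : (0 : ℝ) ≤ (Fintype.card n : ℝ) - 1 := by
    rw [sub_nonneg]
    exact_mod_cast hpos
  have hmul := mul_nonneg hcard (sq_nonneg (hA.eigenvalues i))
  by_contra! hneg
  simp only [Pi.zero_apply] at hneg
  nlinarith

theorem trace_ptB {d : ℕ} (X : MatD d) : (ptB d X).trace = X.trace := rfl

theorem trace_ptB_mul_ptB {d : ℕ} (X Y : MatD d) :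
    (ptB d X * ptB d Y).trace = (X * Y).trace := by
  simp only [Matrix.trace, Matrix.diag_apply, Matrix.mul_apply, ptB, Matrix.of_apply,
    Fintype.sum_prod_type]
  refine Finset.sum_congr rfl fun i _ => ?_
  calc _ = ∑ j, ∑ l, ∑ k, X (i, l) (k, j) * Y (k, j) (i, l) :=
        Finset.sum_congr rfl fun j _ => Finset.sum_comm
    _ = ∑ l, ∑ j, ∑ k, X (i, l) (k, j) * Y (k, j) (i, l) := Finset.sum_comm
    _ = _ := Finset.sum_congr rfl fun l _ => Finset.sum_comm

theorem Matrix.IsHermitian.ptB {d : ℕ} {X : MatD d} (hX : X.IsHermitian) :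
    (ptB d X).IsHermitian :=
  Matrix.IsHermitian.ext fun p q => hX.apply (p.1, q.2) (q.1, p.2)

/-- A two-qutrit state of purity at most `1/8` has positive partial transpose. -/
theorem IsDensity.posSemidef_ptB_of_purity_le {ρ : MatD 3} (hρ : IsDensity 3 ρ)
    (hpur : ((ρ * ρ).trace).re ≤ 1 / 8) : (ptB 3 ρ).PosSemidef := by
  refine hρ.1.isHermitian.ptB.posSemidef_of_trace_mul_self_le ?_ ?_
  · simp [trace_ptB, hρ.2]
  · rw [trace_ptB_mul_ptB, trace_ptB, hρ.2]
    norm_num [Fintype.card_prod]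
    linarith

theorem IsDensity.unitary_conj {d : ℕ} {ρ : MatD d} (hρ : IsDensity d ρ) {U : MatD d}
    (hU : U ∈ Matrix.unitaryGroup (Fin d × Fin d) ℂ) : IsDensity d (U * ρ * star U) :=
  ⟨hρ.1.mul_mul_conjTranspose_same U, by
    rw [trace_mul_comm, ← mul_assoc, Matrix.mem_unitaryGroup_iff'.mp hU, one_mul, hρ.2]⟩

theorem trace_unitary_conj_mul_self {n : Type*} [Fintype n] [DecidableEq n]
    (A : Matrix n n ℂ) {U : Matrix n n ℂ} (hU : U ∈ Matrix.unitaryGroup n ℂ) :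
    ((U * A * star U) * (U * A * star U)).trace = (A * A).trace := by
  have h : (U * A * star U) * (U * A * star U) = U * (A * A) * star U := by
    calc _ = U * A * (star U * U) * A * star U := by simp only [mul_assoc]
      _ = _ := by rw [Matrix.mem_unitaryGroup_iff'.mp hU]; simp only [mul_assoc, one_mul]
  rw [h, trace_mul_comm, ← mul_assoc, Matrix.mem_unitaryGroup_iff'.mp hU, one_mul]

/-- a two-qutrit state with purity `Tr(ρ²) ≤ 1/8` stays PPT under
every global unitary; in particular `ρ` itself is PPT. -/
theorem purity_implies_absolutely_PPT (ρ : MatD 3) (hρ : IsDensity 3 ρ)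
    (hpur : ((ρ * ρ).trace).re ≤ 1 / 8) :
    (∀ U ∈ Matrix.unitaryGroup (Fin 3 × Fin 3) ℂ,
      (ptB 3 (U * ρ * star U)).PosSemidef) ∧
    (ptB 3 ρ).PosSemidef := by
  exact ⟨fun U hU => (hρ.unitary_conj hU).posSemidef_ptB_of_purity_le
    (by rwa [trace_unitary_conj_mul_self ρ hU]), hρ.posSemidef_ptB_of_purity_le hpur⟩
end

section
/- Moment criterion for r-absolute Schmidt number (Theorem 3): let ρ ∈ r-ABSN, let Λ be a linear map on d×d complex matrices such that (id⊗Λ)(τ) is positive semidefinite for every density matrix τ ∈ S_r, let U be a unitary (d²)×(d²) matrix, and suppose t := Re Tr[(id⊗Λ)(U ρ U†)] > 0. Define S = (1/t)·(id⊗Λ)(U ρ U†) and s_k = Re Tr(S^k) for k ≥ 1. Then for every m ≥ 0 the (m+1)×(m+1) Hankel matrix H_m(s) with entries (H_m)_{ij} = s_{i+j+1} (i,j ∈ {0,…,m}) satisfies det[H_m(s)] ≥ 0. -/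
open Matrix BigOperators
open scoped ComplexOrder

/-- The map `id ⊗ Λ` acting on matrices on `ℂ^d ⊗ ℂ^d`:
`((id⊗Λ)X)((i,k),(j,l)) = (Λ(X^{(i,j)})) k l` where `X^{(i,j)} k l = X ((i,k),(j,l))`. -/
def idTensor (d : ℕ) (Λ : Matrix (Fin d) (Fin d) ℂ →ₗ[ℂ] Matrix (Fin d) (Fin d) ℂ)
    (X : MatD d) : MatD d :=
  Matrix.of fun p q => Λ (Matrix.of fun k l => X (p.1, k) (q.1, l)) p.2 q.2

/-- The Hankel matrix of the shifted moments `Re Tr (A ^ (i + j + 1))` of a positive semidefinite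
matrix `A` is positive semidefinite. -/
theorem Matrix.PosSemidef.hankel_trace_pow {n : Type*} [Fintype n] [DecidableEq n]
    {A : Matrix n n ℂ} (hA : A.PosSemidef) (N : ℕ) :
    (Matrix.of fun i j : Fin N => ((A ^ ((i : ℕ) + (j : ℕ) + 1)).trace).re).PosSemidef := by
  refine Matrix.PosSemidef.of_dotProduct_mulVec_nonneg ?_ fun x => ?_
  · ext i j
    simp [Matrix.conjTranspose_apply, add_comm (i : ℕ) j]
  set B : Matrix n n ℂ := ∑ i : Fin N, x i • A ^ (i : ℕ) with hB
  have hBH : Bᴴ = B := by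
    simp [hB, Matrix.conjTranspose_sum, Matrix.conjTranspose_smul, Matrix.conjTranspose_pow,
      hA.isHermitian.eq]
  have hnonneg : 0 ≤ ((B * A * Bᴴ).trace).re :=
    (Complex.nonneg_iff.mp (hA.mul_mul_conjTranspose_same B).trace_nonneg).1
  refine hnonneg.trans_eq ?_
  rw [hBH, hB]
  simp only [dotProduct, Matrix.mulVec, Matrix.of_apply, star_trivial, Finset.mul_sum,
    Finset.sum_mul, Matrix.trace_sum, Complex.re_sum]
  rw [Finset.sum_comm]
  refine Finset.sum_congr rfl fun i _ => Finset.sum_congr rfl fun j _ => ?_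
  have hpow : A ^ (i : ℕ) * A * A ^ (j : ℕ) = A ^ ((i : ℕ) + j + 1) := by
    rw [← pow_succ, ← pow_add]
    congr 1
    omega
  rw [smul_mul_assoc, smul_mul_assoc, mul_smul_comm, hpow, Matrix.trace_smul, Matrix.trace_smul,
    Complex.smul_re, Complex.smul_re, smul_eq_mul, smul_eq_mul]
  ring

/-- Theorem 3: moment criterion for `r`-absolute Schmidt number.
If `ρ ∈ r`-ABSN, `Λ` maps all states of Schmidt number at most `r` to positive
semidefinite matrices under `id ⊗ Λ`, `U` is a global unitary, and
`t = Re Tr[(id⊗Λ)(UρU†)] > 0`, then all Hankel determinants of the moments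
`s_k = Re Tr(S^k)` of `S = t⁻¹ (id⊗Λ)(UρU†)` are nonnegative. -/
theorem absn_moment_criterion (d r : ℕ) (hd : 1 ≤ d) (hr : 1 ≤ r)
    (Λ : Matrix (Fin d) (Fin d) ℂ →ₗ[ℂ] Matrix (Fin d) (Fin d) ℂ)
    (hΛ : ∀ τ : MatD d, IsDensity d τ → InSchmidt d r τ → (idTensor d Λ τ).PosSemidef)
    (ρ : MatD d) (hρ : InABSN d r ρ)
    (U : MatD d) (hU : U ∈ Matrix.unitaryGroup (Fin d × Fin d) ℂ)
    (t : ℝ) (ht : t = ((idTensor d Λ (U * ρ * star U)).trace).re) (htpos : 0 < t)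
    (m : ℕ) :
    0 ≤ (Matrix.of fun i j : Fin (m + 1) =>
        (((t⁻¹ • idTensor d Λ (U * ρ * star U)) ^ ((i : ℕ) + (j : ℕ) + 1)).trace).re).det := by
  have hS := hΛ _ (hρ.1.unitary_conj hU) (hρ.2 U hU)
  exact ((hS.smul (inv_nonneg.mpr htpos.le)).hankel_trace_pow (m + 1)).det_nonneg
end

section
/- Faithfulness of the generalized r-absolute Schmidt robustness: for every density matrix ρ on ℂ^d ⊗ ℂ^d, M_GR(ρ) = 0 if and only if ρ ∈ r-ABSN. -/
open Matrix BigOperators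
open scoped ComplexOrder

/-- The generalized `r`-absolute Schmidt robustness: the infimum (in `[0,∞]`) of
`t ≥ 0` such that `(ρ + t χ)/(1+t) ∈ r`-ABSN for some density matrix `χ`. -/
noncomputable def MGR (d r : ℕ) (ρ : MatD d) : ENNReal :=
  sInf {s : ENNReal | ∃ t : ℝ, 0 ≤ t ∧ s = ENNReal.ofReal t ∧
    ∃ χ : MatD d, IsDensity d χ ∧ InABSN d r ((1 / (1 + t)) • (ρ + t • χ))}


open Filter Topology in
/-- Rank is lower semicontinuous, so the matrices of rank at most `r` form a closed set. -/
lemma Matrix.isClosed_setOf_rank_le {𝕜 m n : Type*} [NontriviallyNormedField 𝕜] [CompleteSpace 𝕜]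
    [Fintype m] [Fintype n] (r : ℕ) : IsClosed {A : Matrix m n 𝕜 | A.rank ≤ r} := by
  have h : {A : Matrix m n 𝕜 | A.rank ≤ r}ᶜ =
      ⋃ c : Fin (r + 1) → n, {A | LinearIndependent 𝕜 fun k => A.col (c k)} := by
    ext A
    simp only [Set.mem_compl_iff, Set.mem_ofPred_eq, not_le, Set.mem_iUnion]
    rw [rank_eq_finrank_span_cols]
    constructor
    · intro hA
      obtain ⟨f, hf, -, hli⟩ := Submodule.exists_fun_fin_finrank_span_eq 𝕜 (Set.range A.col)
      choose c hc using hf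
      refine ⟨fun k => c (Fin.castLE hA k), ?_⟩
      simp only [hc]
      exact hli.comp _ (Fin.castLE_injective hA)
    · rintro ⟨c, hc⟩
      have h1 := finrank_span_eq_card hc
      rw [Fintype.card_fin] at h1
      have h2 : Submodule.span 𝕜 (Set.range fun k => A.col (c k)) ≤
          Submodule.span 𝕜 (Set.range A.col) :=
        Submodule.span_mono (Set.range_subset_iff.2 fun k => ⟨c k, rfl⟩)
      have := Submodule.finrank_mono h2
      omega
  rw [← isOpen_compl_iff, h]
  refine isOpen_iUnion fun c => ?_
  refine (isOpen_setOfPred_linearIndependent (𝕜 := 𝕜) (E := m → 𝕜)).preimage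
    (f := fun (A : Matrix m n 𝕜) k => A.col (c k)) ?_
  exact continuous_pi fun k => continuous_pi fun i => continuous_id.matrix_elem i (c k)

/-- In finite dimension, the convex hull of a compact set is compact. -/
lemma IsCompact.convexHull_of_finiteDimensional {E : Type*} [AddCommGroup E] [Module ℝ E]
    [FiniteDimensional ℝ E] [TopologicalSpace E] [ContinuousAdd E] [ContinuousSMul ℝ E]
    {K : Set E} (hK : IsCompact K) : IsCompact (convexHull ℝ K) := by
  have h : convexHull ℝ K = ⋃ n ∈ Set.Iic (Module.finrank ℝ E + 1),
      (fun q : (Fin n → ℝ) × (Fin n → E) => ∑ i, q.1 i • q.2 i) ''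
        (stdSimplex ℝ (Fin n) ×ˢ Set.univ.pi fun _ => K) := by
    ext x
    simp only [Set.mem_iUnion, Set.mem_image, Set.mem_prod, Set.mem_univ_pi, Prod.exists,
      Set.mem_Iic]
    constructor
    · intro hx
      obtain ⟨ι, _, z, w, hz, hai, hw, hw1, rfl⟩ := eq_pos_convex_span_of_mem_convexHull hx
      let e := Fintype.equivFin ι
      refine ⟨Fintype.card ι, ?_, w ∘ e.symm, z ∘ e.symm,
        ⟨⟨fun i => (hw _).le, ?_⟩, fun i => hz ⟨_, rfl⟩⟩, ?_⟩
      · have h1 := hai.card_le_finrank_succ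
        have h2 := Submodule.finrank_le (vectorSpan ℝ (Set.range z))
        omega
      · rw [← hw1]
        exact e.symm.sum_comp w
      · exact e.symm.sum_comp fun i => w i • z i
    · rintro ⟨n, -, w, z, ⟨hw, hz⟩, rfl⟩
      exact mem_convexHull_of_exists_fintype w z hw.1 hw.2 hz rfl
  rw [h]
  refine (Set.finite_Iic _).isCompact_biUnion fun n _ => ?_
  refine ((isCompact_stdSimplex ℝ (Fin n)).prod (isCompact_univ_pi fun _ => hK)).image ?_
  fun_prop

/-- The unit vectors of Schmidt rank at most `r`. -/
def unitSchmidtVectors (d r : ℕ) : Set (Fin d × Fin d → ℂ) :=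
  {ψ | ∑ x, Complex.normSq (ψ x) = 1 ∧ (Matrix.of fun i j => ψ (i, j)).rank ≤ r}

lemma isCompact_unitSchmidtVectors (d r : ℕ) : IsCompact (unitSchmidtVectors d r) := by
  refine (isCompact_univ_pi fun _ => isCompact_closedBall (0 : ℂ) 1).of_isClosed_subset ?_ ?_
  · refine IsClosed.inter (isClosed_eq ?_ continuous_const)
      ((Matrix.isClosed_setOf_rank_le r).preimage ?_)
    · exact continuous_finsetSum _ fun x _ => Complex.continuous_normSq.comp (continuous_apply x)
    · exact continuous_matrix fun i j => continuous_apply (i, j)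
  · rintro ψ ⟨hψ, -⟩ x -
    have h : Complex.normSq (ψ x) ≤ 1 := hψ ▸
      Finset.single_le_sum (f := fun x => Complex.normSq (ψ x))
        (fun x _ => Complex.normSq_nonneg _) (Finset.mem_univ x)
    rw [Complex.normSq_eq_norm_sq] at h
    rw [mem_closedBall_zero_iff]
    exact (sq_le_one_iff₀ (norm_nonneg _)).1 h

lemma setOf_inSchmidt_eq_convexHull (d r : ℕ) :
    {ρ | InSchmidt d r ρ} =
      convexHull ℝ ((fun ψ => vecMulVec ψ (star ψ)) '' unitSchmidtVectors d r) := by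
  ext ρ
  constructor
  · rintro ⟨n, p, ψ, hp, hp1, hψ, hrank, rfl⟩
    exact mem_convexHull_of_exists_fintype p (fun k => vecMulVec (ψ k) (star (ψ k))) hp hp1
      (fun k => ⟨ψ k, ⟨hψ k, hrank k⟩, rfl⟩) (by simp only [Complex.coe_smul])
  · intro h
    obtain ⟨ι, _, w, z, hw, hw1, hz, rfl⟩ := mem_convexHull_iff_exists_fintype.1 h
    choose ψ hψ hψz using hz
    let e := Fintype.equivFin ι
    refine ⟨Fintype.card ι, w ∘ e.symm, ψ ∘ e.symm, fun k => hw _, ?_, fun k => (hψ _).1,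
      fun k => (hψ _).2, ?_⟩
    · rw [← hw1]
      exact e.symm.sum_comp w
    · simp only [Function.comp_apply, Complex.coe_smul]
      rw [e.symm.sum_comp fun i => w i • vecMulVec (ψ i) (star (ψ i))]
      exact Finset.sum_congr rfl fun i _ => by rw [← hψz i]

lemma isClosed_setOf_inSchmidt (d r : ℕ) : IsClosed {ρ | InSchmidt d r ρ} := by
  rw [setOf_inSchmidt_eq_convexHull]
  refine ((isCompact_unitSchmidtVectors d r).image ?_).convexHull_of_finiteDimensional.isClosed
  exact continuous_id.matrix_vecMulVec continuous_star

/-- The entries of a density matrix are bounded by `1` in absolute value. -/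
lemma IsDensity.norm_apply_le_one {d : ℕ} {χ : MatD d} (hχ : IsDensity d χ)
    (i j : Fin d × Fin d) : ‖χ i j‖ ≤ 1 := by
  have hdiag (k) : 0 ≤ (χ k k).re ∧ (χ k k).im = 0 := by
    have := Complex.le_def.1 (hχ.1.diag_nonneg (i := k))
    exact ⟨this.1, this.2.symm⟩
  have hle (k) : (χ k k).re ≤ 1 := by
    have htr : ∑ k, (χ k k).re = 1 := by
      rw [← Complex.re_sum]
      exact congrArg Complex.re hχ.2
    exact htr ▸ Finset.single_le_sum (f := fun k => (χ k k).re)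
      (fun k _ => (hdiag k).1) (Finset.mem_univ k)
  have hdet := (hχ.1.submatrix ![i, j]).det_nonneg
  rw [Matrix.det_fin_two] at hdet
  simp only [Matrix.submatrix_apply, Matrix.cons_val_zero, Matrix.cons_val_one] at hdet
  rw [← hχ.1.1.apply j i, Complex.star_def, Complex.mul_conj] at hdet
  have h := (Complex.le_def.1 hdet).1
  simp only [Complex.zero_re, Complex.sub_re, Complex.mul_re, (hdiag i).2, (hdiag j).2,
    Complex.ofReal_re, Complex.normSq_eq_norm_sq] at h
  have := mul_le_one₀ (hle i) (hdiag j).1 (hle j)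
  exact (sq_le_one_iff₀ (norm_nonneg _)).1 (by linarith)

open Filter Topology in
/-- Mixing `ρ` with density matrices of vanishing weight converges to `ρ`. -/
lemma tendsto_mixture {d : ℕ} (ρ : MatD d) {t : ℕ → ℝ} {χ : ℕ → MatD d}
    (ht : Tendsto t atTop (𝓝 0)) (hχ : ∀ n, IsDensity d (χ n)) :
    Tendsto (fun n => (1 / (1 + t n)) • (ρ + t n • χ n)) atTop (𝓝 ρ) := by
  have hsmul : Tendsto (fun n => t n • χ n) atTop (𝓝 0) := by
    refine tendsto_pi_nhds.2 fun i => tendsto_pi_nhds.2 fun j => ?_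
    refine squeeze_zero_norm (fun n => ?_) (tendsto_norm_zero.comp ht)
    simpa [norm_smul] using
      mul_le_of_le_one_right (abs_nonneg (t n)) ((hχ n).norm_apply_le_one i j)
  have hc : Tendsto (fun n => 1 / (1 + t n)) atTop (𝓝 1) := by
    simpa using (ht.const_add 1).inv₀ (by simp)
  simpa using hc.smul (hsmul.const_add ρ)

/-- faithfulness of the generalized `r`-absolute Schmidt robustness:
`M_GR(ρ) = 0` iff `ρ ∈ r`-ABSN. -/
theorem MGR_eq_zero_iff (d r : ℕ) (hd : 1 ≤ d) (hr : 1 ≤ r)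
    (ρ : MatD d) (hρ : IsDensity d ρ) :
    MGR d r ρ = 0 ↔ InABSN d r ρ := by
  constructor
  · intro h
    have hex (n : ℕ) : ∃ t : ℝ, ∃ χ : MatD d, 0 ≤ t ∧ t < 1 / ((n : ℝ) + 1) ∧ IsDensity d χ ∧
        InABSN d r ((1 / (1 + t)) • (ρ + t • χ)) := by
      have hpos : (0 : ℝ) < 1 / ((n : ℝ) + 1) := by positivity
      have hlt : MGR d r ρ < ENNReal.ofReal (1 / ((n : ℝ) + 1)) := by
        rw [h]
        exact ENNReal.ofReal_pos.2 hpos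
      obtain ⟨_, ⟨t, ht0, rfl, χ, hχ, hmix⟩, ht⟩ := sInf_lt_iff.1 hlt
      exact ⟨t, χ, ht0, (ENNReal.ofReal_lt_ofReal_iff hpos).1 ht, hχ, hmix⟩
    choose t χ ht0 ht hχ hmix using hex
    have hlim := tendsto_mixture ρ
      (squeeze_zero ht0 (fun n => (ht n).le) tendsto_one_div_add_atTop_nhds_zero_nat) hχ
    refine ⟨hρ, fun U hU => ?_⟩
    have hcont : Continuous fun σ : MatD d => U * σ * star U := by fun_prop
    exact (isClosed_setOf_inSchmidt d r).mem_of_tendsto ((hcont.tendsto ρ).comp hlim)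
      (Filter.Eventually.of_forall fun n => (hmix n).2 U hU)
  · intro h
    refine le_antisymm (sInf_le ⟨0, le_rfl, by simp, ρ, hρ, ?_⟩) zero_le
    simpa using h
end
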